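/- arXiv:1407.7831 — 2 statements merged into one kernel-verified Lean document; each statement's English description precedes it below -/
import Mathlib

section
/- (Positivity of f(ε₀,1,3) in Subcase 1 of Lemma 3.2.) Let μ > 0, λ ∈ ℝ, and ε₀ ∈ (0, 1/4) be real numbers, and set a₁ = (13 − 10ε₀ + 2√(64 + ε₀² − 56ε₀))/3. If (5 − 8ε₀)μ/3 < λ < a₁μ, then 16μ²(1 − ε₀)/(3λ − (5 − 8ε₀)μ) + μ(2 − ε₀) − (μ + λ)/4 > 0. -/
/-- Positivity of f(ε₀,1,3) in Subcase 1 of Lemma 3.2. -/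
theorem f_pos (μ lam ε₀ : ℝ) (hμ : 0 < μ) (hε : ε₀ ∈ Set.Ioo (0 : ℝ) (1 / 4))
    (hlow : (5 - 8 * ε₀) * μ / 3 < lam)
    (hhigh : lam < (13 - 10 * ε₀ + 2 * Real.sqrt (64 + ε₀ ^ 2 - 56 * ε₀)) / 3 * μ) :
    0 < 16 * μ ^ 2 * (1 - ε₀) / (3 * lam - (5 - 8 * ε₀) * μ) + μ * (2 - ε₀)
        - (μ + lam) / 4 := by
  obtain ⟨hε0, hε1⟩ := hε
  set s := Real.sqrt (64 + ε₀ ^ 2 - 56 * ε₀)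
  have hsq : s ^ 2 = 64 + ε₀ ^ 2 - 56 * ε₀ := Real.sq_sqrt (by nlinarith)
  have hs_lower : 4 - ε₀ < s := Real.lt_sqrt_of_sq_lt (by nlinarith)
  obtain ⟨D, hD⟩ : ∃ D, D = 3 * lam - (5 - 8 * ε₀) * μ := ⟨_, rfl⟩
  have hlam : lam = (D + (5 - 8 * ε₀) * μ) / 3 := by linarith
  have hDpos : 0 < D := by linarith
  have hupper : 0 < (8 - 2 * ε₀) * μ + 2 * s * μ - D := by linarith
  have hlower : 0 < D - (8 - 2 * ε₀) * μ + 2 * s * μ := by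
    linarith [mul_lt_mul_of_pos_right hs_lower hμ]
  have hfactor : 16 * μ ^ 2 * (1 - ε₀) / D + μ * (2 - ε₀) - (μ + lam) / 4 =
      ((8 - 2 * ε₀) * μ + 2 * s * μ - D) * (D - (8 - 2 * ε₀) * μ + 2 * s * μ) /
        (12 * D) := by
    rw [hlam]
    field_simp
    linear_combination (-48 * μ ^ 2) * hsq
  rw [← hD, hfactor]
  positivity
end

section
/- (Lower bound (3.28) for G.) Let μ > 0, λ ∈ ℝ with μ + λ ≥ 0, ε₀ ∈ (0, 1), and r > 1 be real numbers, and let u : ℝ³ → ℝ³ be differentiable at x ∈ ℝ³ with u(x) ≠ 0. Write n = |u|, w = u/|u|, all derivatives evaluated at x, and define G = μ(1 − ε₀)|u|²|∇u|² + (μ + λ)|u|²(div u)² + μ(r − 2)|u|²|∇n|² + (r − 2)(μ + λ)|u|²(u·∇n)(div w) + (r − 2)(μ + λ)(u·∇n)². Then G ≥ μ(r − 1 − ε₀)|u|²|∇n|² + ((4 − ε₀)μ/3 + λ − r²(μ + λ)/(4(r − 1)))|u|⁴(div w)². -/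
open scoped BigOperators

/-- j-th partial derivative of a scalar function at a point. -/
noncomputable def pd (j : Fin 3) (f : (Fin 3 → ℝ) → ℝ) (x : Fin 3 → ℝ) : ℝ :=
  fderiv ℝ f x (Pi.single j 1)

/-- Divergence of a vector field at a point. -/
noncomputable def vdiv (F : (Fin 3 → ℝ) → (Fin 3 → ℝ)) (x : Fin 3 → ℝ) : ℝ :=
  ∑ j, pd j (fun y => F y j) x

/-- Curl (rot) of a vector field at a point. -/
noncomputable def rot (F : (Fin 3 → ℝ) → (Fin 3 → ℝ)) (x : Fin 3 → ℝ) : Fin 3 → ℝ :=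
  ![pd 1 (fun y => F y 2) x - pd 2 (fun y => F y 1) x,
    pd 2 (fun y => F y 0) x - pd 0 (fun y => F y 2) x,
    pd 0 (fun y => F y 1) x - pd 1 (fun y => F y 0) x]

/-- Cross product on ℝ³. -/
def cross (a b : Fin 3 → ℝ) : Fin 3 → ℝ :=
  ![a 1 * b 2 - a 2 * b 1, a 2 * b 0 - a 0 * b 2, a 0 * b 1 - a 1 * b 0]

/-- Euclidean norm on ℝ³. -/
noncomputable def nrm (v : Fin 3 → ℝ) : ℝ := Real.sqrt (∑ i, v i ^ 2)

theorem pd_mul {f g : (Fin 3 → ℝ) → ℝ} {x : Fin 3 → ℝ} (hf : DifferentiableAt ℝ f x)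
    (hg : DifferentiableAt ℝ g x) (j : Fin 3) :
    pd j (fun y => f y * g y) x = f x * pd j g x + g x * pd j f x := by
  simp [pd, fderiv_fun_mul hf hg]

theorem nrm_sq (v : Fin 3 → ℝ) : nrm v ^ 2 = ∑ i, v i ^ 2 :=
  Real.sq_sqrt (Finset.sum_nonneg fun i _ => sq_nonneg (v i))

theorem nrm_eq_zero_iff {v : Fin 3 → ℝ} : nrm v = 0 ↔ v = 0 := by
  rw [← sq_eq_zero_iff, nrm_sq, Finset.sum_eq_zero_iff_of_nonneg fun i _ => sq_nonneg (v i)]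
  simp [funext_iff]

theorem nrm_mul_div_nrm (v : Fin 3 → ℝ) (i : Fin 3) : nrm v * (v i / nrm v) = v i := by
  by_cases h : nrm v = 0
  · simp [nrm_eq_zero_iff.mp h]
  · exact mul_div_cancel₀ _ h

theorem differentiableAt_nrm {u : (Fin 3 → ℝ) → (Fin 3 → ℝ)} {x : Fin 3 → ℝ}
    (hu : DifferentiableAt ℝ u x) (hne : u x ≠ 0) :
    DifferentiableAt ℝ (fun y => nrm (u y)) x := by
  have hsum : DifferentiableAt ℝ (fun y => ∑ i, u y i ^ 2) x :=
    DifferentiableAt.fun_sum fun i _ => (differentiableAt_pi.mp hu i).pow 2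
  refine hsum.sqrt ?_
  rw [← nrm_sq]
  exact pow_ne_zero 2 (mt nrm_eq_zero_iff.mp hne)

/-- The derivative of `|u|² = ∑ (uⁱ)²`. -/
theorem nrm_mul_pd_nrm {u : (Fin 3 → ℝ) → (Fin 3 → ℝ)} {x : Fin 3 → ℝ}
    (hu : DifferentiableAt ℝ u x) (hne : u x ≠ 0) (j : Fin 3) :
    nrm (u x) * pd j (fun y => nrm (u y)) x = ∑ i, u x i * pd j (fun y => u y i) x := by
  have hi := differentiableAt_pi.mp hu
  have hn := differentiableAt_nrm hu hne
  have hsq : (fun y => nrm (u y) * nrm (u y)) = fun y => ∑ i, u y i * u y i := by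
    funext y
    simpa only [pow_two] using nrm_sq (u y)
  have hsum : pd j (fun y => ∑ i, u y i * u y i) x = ∑ i, pd j (fun y => u y i * u y i) x := by
    simp only [pd]
    rw [fderiv_fun_sum fun i _ => (hi i).fun_mul (hi i), sum_apply]
  have h := pd_mul hn hn j
  rw [hsq, hsum] at h
  simp only [pd_mul (hi _) (hi _) j, ← two_mul, ← Finset.mul_sum] at h
  linarith

/-- The product rule for `u = |u| w`. -/
theorem pd_eq_polar {u : (Fin 3 → ℝ) → (Fin 3 → ℝ)} {x : Fin 3 → ℝ}
    (hu : DifferentiableAt ℝ u x) (hne : u x ≠ 0) (i j : Fin 3) :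
    pd j (fun y => u y i) x = nrm (u x) * pd j (fun y => u y i / nrm (u y)) x
      + u x i / nrm (u x) * pd j (fun y => nrm (u y)) x := by
  have hn := differentiableAt_nrm hu hne
  have hw : DifferentiableAt ℝ (fun y => u y i / nrm (u y)) x := by
    simp only [div_eq_mul_inv]
    exact (differentiableAt_pi.mp hu i).fun_mul (hn.fun_inv (mt nrm_eq_zero_iff.mp hne))
  rw [← pd_mul hn hw j]
  simp only [nrm_mul_div_nrm]

theorem trace_sq_le (A : Fin 3 → Fin 3 → ℝ) : (∑ j, A j j) ^ 2 ≤ 3 * ∑ i, ∑ j, A i j ^ 2 := by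
  simp only [Fin.sum_univ_three]
  nlinarith [sq_nonneg (A 0 0 - A 1 1), sq_nonneg (A 0 0 - A 2 2), sq_nonneg (A 1 1 - A 2 2),
    sq_nonneg (A 0 1), sq_nonneg (A 0 2), sq_nonneg (A 1 0), sq_nonneg (A 1 2),
    sq_nonneg (A 2 0), sq_nonneg (A 2 1)]

/-- The decomposition `|∇u|² = |∇n|² + n² |∇w|²`, for `w` a unit vector orthogonal to the
columns of `A`. -/
theorem sum_sq_polar {n : ℝ} {w g : Fin 3 → ℝ} {A : Fin 3 → Fin 3 → ℝ}
    (hw : ∑ i, w i ^ 2 = 1) (hA : ∀ j, ∑ i, w i * A i j = 0) :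
    ∑ i, ∑ j, (n * A i j + w i * g j) ^ 2 = ∑ j, g j ^ 2 + n ^ 2 * ∑ i, ∑ j, A i j ^ 2 := by
  have h0 := hA 0
  have h1 := hA 1
  have h2 := hA 2
  simp only [Fin.sum_univ_three] at *
  linear_combination (g 0 ^ 2 + g 1 ^ 2 + g 2 ^ 2) * hw + 2 * n * g 0 * h0 + 2 * n * g 1 * h1
    + 2 * n * g 2 * h2

/-- Completing the square in `s`. -/
theorem one_sub_mul_sq_le {r : ℝ} (hr : 1 < r) (s t : ℝ) :
    (1 - r ^ 2 / (4 * (r - 1))) * t ^ 2 ≤ (s + t) ^ 2 + (r - 2) * s * t + (r - 2) * s ^ 2 := by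
  have h : 0 < r - 1 := sub_pos.mpr hr
  have key : (s + t) ^ 2 + (r - 2) * s * t + (r - 2) * s ^ 2
      - (1 - r ^ 2 / (4 * (r - 1))) * t ^ 2 = (2 * (r - 1) * s + r * t) ^ 2 / (4 * (r - 1)) := by
    field_simp
    ring
  have : 0 ≤ (2 * (r - 1) * s + r * t) ^ 2 / (4 * (r - 1)) := by positivity
  linarith

/-- Lower bound (3.28) for G. -/
theorem G_lower_bound (μ lam ε₀ r : ℝ) (hμ : 0 < μ) (hlame : 0 ≤ μ + lam)
    (hε : ε₀ ∈ Set.Ioo (0 : ℝ) 1) (hr : 1 < r)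
    (u : (Fin 3 → ℝ) → (Fin 3 → ℝ)) (x : Fin 3 → ℝ)
    (hu : DifferentiableAt ℝ u x) (hne : u x ≠ 0) :
    μ * (r - 1 - ε₀) * nrm (u x) ^ 2 * (∑ j, (pd j (fun y => nrm (u y)) x) ^ 2)
        + ((4 - ε₀) * μ / 3 + lam - r ^ 2 * (μ + lam) / (4 * (r - 1)))
            * nrm (u x) ^ 4 * (vdiv (fun y i => u y i / nrm (u y)) x) ^ 2
      ≤ μ * (1 - ε₀) * nrm (u x) ^ 2 * (∑ i, ∑ j, (pd j (fun y => u y i) x) ^ 2)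
        + (μ + lam) * nrm (u x) ^ 2 * (vdiv u x) ^ 2
        + μ * (r - 2) * nrm (u x) ^ 2 * (∑ j, (pd j (fun y => nrm (u y)) x) ^ 2)
        + (r - 2) * (μ + lam) * nrm (u x) ^ 2
            * (∑ j, u x j * pd j (fun y => nrm (u y)) x)
            * vdiv (fun y i => u y i / nrm (u y)) x
        + (r - 2) * (μ + lam) * (∑ j, u x j * pd j (fun y => nrm (u y)) x) ^ 2 := by
  have hn : nrm (u x) ≠ 0 := mt nrm_eq_zero_iff.mp hne
  have hpolar := pd_eq_polar hu hne
  have hgrad := nrm_mul_pd_nrm hu hne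
  have hunit : ∑ i, (u x i / nrm (u x)) ^ 2 = 1 := by
    simp only [div_pow, ← Finset.sum_div, ← nrm_sq]
    exact div_self (pow_ne_zero 2 hn)
  have hux (i : Fin 3) : u x i = nrm (u x) * (u x i / nrm (u x)) := (nrm_mul_div_nrm _ i).symm
  simp only [vdiv, hpolar] at hgrad ⊢
  generalize hw : (fun i => u x i / nrm (u x)) = w at *
  replace hw (i : Fin 3) : u x i / nrm (u x) = w i := congrFun hw i
  generalize hg : (fun j => pd j (fun y => nrm (u y)) x) = g
  replace hg (j : Fin 3) : pd j (fun y => nrm (u y)) x = g j := congrFun hg j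
  generalize hA : (fun i j => pd j (fun y => u y i / nrm (u y)) x) = A
  replace hA (i j : Fin 3) : pd j (fun y => u y i / nrm (u y)) x = A i j :=
    congrFun (congrFun hA i) j
  simp only [hw] at hux hunit
  simp only [hw, hg, hA] at hgrad ⊢
  simp only [hux] at hgrad ⊢
  clear hpolar hw hux
  generalize nrm (u x) = n at *
  have horth (j : Fin 3) : ∑ i, w i * A i j = 0 := by
    have h := hgrad j
    simp only [Fin.sum_univ_three] at h hunit ⊢
    refine mul_left_cancel₀ (pow_ne_zero 2 hn) ?_
    linear_combination -h - n * g j * hunit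
  rw [sum_sq_polar hunit horth]
  simp only [Finset.sum_add_distrib, mul_assoc n, ← Finset.mul_sum]
  have htrace := trace_sq_le A
  generalize ∑ j, A j j = D at *
  generalize ∑ i, ∑ j, A i j ^ 2 = N at *
  generalize ∑ j, w j * g j = s at *
  have h1 := mul_le_mul_of_nonneg_left (one_sub_mul_sq_le hr s (n * D))
    (mul_nonneg hlame (sq_nonneg n))
  have h2 : 0 ≤ μ * (1 - ε₀) * n ^ 4 * (3 * N - D ^ 2) :=
    mul_nonneg (mul_nonneg (mul_nonneg hμ.le (by linarith [hε.2])) (by positivity))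
      (sub_nonneg.mpr htrace)
  have hdiv : r ^ 2 * (μ + lam) / (4 * (r - 1)) = (μ + lam) * (r ^ 2 / (4 * (r - 1))) := by ring
  rw [hdiv]
  linear_combination h1 + h2 / 3
end
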